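/- The handshake identity for the e-adjacency tensor: the sum of r(t) over all tuples t : Fin k → Fin N equals k · |E|, the order k times the total number of hyperedges of the original hypergraph. -/

import Mathlib

open Finset

/-- Embedding of the original vertices `Fin n` into the extended vertex set `Fin (n + k - 1)`. -/
def emb (n k : ℕ) (hk : 1 ≤ k) (v : Fin n) : Fin (n + k - 1) :=
  ⟨(v : ℕ), by have := v.isLt; omega⟩

/-- The additional vertex `y_{j+1}` corresponds to the index `n + j` of `Fin (n + k - 1)`. -/
def addIdx (n k : ℕ) (j : Fin (k - 1)) : Fin (n + k - 1) :=
  ⟨n + (j : ℕ), by have := j.isLt; omega⟩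

/-- The set of additional indices `{n+s-1, ..., n+k-2}` used to fill a hyperedge `e`
of cardinality `s`. -/
def addSet (n k : ℕ) (e : Finset (Fin n)) : Finset (Fin (n + k - 1)) :=
  (Finset.univ.filter fun j : Fin (k - 1) => e.card - 1 ≤ (j : ℕ)).image (addIdx n k)

/-- The filled hyperedge `ê ⊆ Fin (n + k - 1)` of a hyperedge `e ⊆ Fin n`. -/
def filled (n k : ℕ) (hk : 1 ≤ k) (e : Finset (Fin n)) : Finset (Fin (n + k - 1)) :=
  e.image (emb n k hk) ∪ addSet n k e

/-- The e-adjacency tensor of the hypergraph with hyperedge family `E`: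
`r t = 1/(k-1)!` if `t` is injective with image a filled hyperedge, and `0` otherwise. -/
noncomputable def eAdj (n k : ℕ) (hk : 1 ≤ k) (E : Finset (Finset (Fin n))) :
    (Fin k → Fin (n + k - 1)) → ℝ := fun t =>
  if Function.Injective t ∧ ∃ e ∈ E, Finset.image t Finset.univ = filled n k hk e then
    1 / (Nat.factorial (k - 1)) else 0

/-- The degree of a vertex `v`: the number of hyperedges containing `v`. -/
def deg (n : ℕ) (E : Finset (Finset (Fin n))) (v : Fin n) : ℕ :=
  (E.filter fun e => v ∈ e).card

/-- The tuple `(i, t 0, ..., t (m-2)) : Fin m → Fin N`. -/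
def extend (m N : ℕ) (i : Fin N) (t : Fin (m - 1) → Fin N) : Fin m → Fin N :=
  fun j => if h : (j : ℕ) = 0 then i else t ⟨(j : ℕ) - 1, by have := j.isLt; omega⟩

/-- `(lam, x)` is an eigenpair of the order-`m`, dimension-`N` hypermatrix `T`. -/
def IsEigenpair (m N : ℕ) (T : (Fin m → Fin N) → ℝ) (lam : ℂ) (x : Fin N → ℂ) : Prop :=
  x ≠ 0 ∧ ∀ i : Fin N,
    ∑ t : Fin (m - 1) → Fin N, (T (extend m N i t) : ℂ) * ∏ j : Fin (m - 1), x (t j)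
      = lam * x i ^ (m - 1)

lemma emb_injective (n k : ℕ) (hk : 1 ≤ k) : Function.Injective (emb n k hk) := by
  intro a b h
  simpa [emb, Fin.ext_iff] using h

lemma addIdx_injective (n k : ℕ) : Function.Injective (addIdx n k) := by
  intro a b h
  simpa [addIdx, Fin.ext_iff] using h

lemma emb_ne_addIdx (n k : ℕ) (hk : 1 ≤ k) (v : Fin n) (j : Fin (k - 1)) :
    emb n k hk v ≠ addIdx n k j := by
  have := v.isLt
  simp only [emb, addIdx, ne_eq, Fin.mk.injEq]
  omega

lemma emb_mem_filled_iff (n k : ℕ) (hk : 1 ≤ k) (e : Finset (Fin n)) (v : Fin n) :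
    emb n k hk v ∈ filled n k hk e ↔ v ∈ e := by
  simp [filled, addSet, (emb_injective n k hk).eq_iff, (emb_ne_addIdx n k hk _ _).symm]

lemma filled_injective (n k : ℕ) (hk : 1 ≤ k) : Function.Injective (filled n k hk) := by
  intro e f h
  ext v
  rw [← emb_mem_filled_iff n k hk, h, emb_mem_filled_iff]

lemma card_addSet (n k : ℕ) (e : Finset (Fin n)) :
    (addSet n k e).card = (k - 1) - (e.card - 1) := by
  rw [addSet, card_image_of_injective _ (addIdx_injective n k),
    ← card_map Fin.valEmbedding, ← Nat.card_Ico (e.card - 1) (k - 1)]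
  congr 1
  ext i
  simp only [mem_map, mem_filter, mem_univ, true_and, Fin.valEmbedding_apply, mem_Ico]
  constructor
  · rintro ⟨j, hj, rfl⟩
    exact ⟨hj, j.isLt⟩
  · rintro ⟨h₁, h₂⟩
    exact ⟨⟨i, h₂⟩, h₁, rfl⟩

lemma card_filled (n k : ℕ) (hk : 1 ≤ k) (e : Finset (Fin n)) (he : e.Nonempty)
    (hek : e.card ≤ k) : (filled n k hk e).card = k := by
  have hdisj : Disjoint (e.image (emb n k hk)) (addSet n k e) := by
    simp only [disjoint_left, addSet, mem_image]
    rintro _ ⟨v, -, rfl⟩ ⟨j, -, h⟩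
    exact emb_ne_addIdx n k hk v j h.symm
  rw [filled, card_union_of_disjoint hdisj, card_image_of_injective _ (emb_injective n k hk),
    card_addSet]
  have := he.card_pos
  omega

/-- The number of injective enumerations of a finite set by an index type of the same size. -/
lemma card_injective_image_eq {ι α : Type*} [Fintype ι] [DecidableEq ι] [Fintype α]
    [DecidableEq α] (S : Finset α) (hS : S.card = Fintype.card ι)
    [DecidablePred fun t : ι → α => Function.Injective t ∧ univ.image t = S] :
    (univ.filter fun t : ι → α => Function.Injective t ∧ univ.image t = S).card
      = (Fintype.card ι).factorial := by
  rw [← Fintype.card_equiv (Fintype.equivOfCardEq (by simpa using hS.symm) : ι ≃ S), ← card_univ]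
  symm
  refine card_bij (fun σ _ i => (σ i : α)) ?_ ?_ ?_
  · intro σ _
    refine mem_filter.2 ⟨mem_univ _, Subtype.val_injective.comp σ.injective, ?_⟩
    ext a
    simp only [mem_image, mem_univ, true_and]
    constructor
    · rintro ⟨i, rfl⟩
      exact (σ i).2
    · exact fun ha => ⟨σ.symm ⟨a, ha⟩, by simp⟩
  · intro σ _ τ _ h
    ext i
    exact congrFun h i
  · intro t ht
    obtain ⟨-, hinj, himg⟩ := mem_filter.1 ht
    have hmem : ∀ i, t i ∈ S := fun i => himg ▸ mem_image_of_mem t (mem_univ i)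
    refine ⟨Equiv.ofBijective (fun i => (⟨t i, hmem i⟩ : S)) ⟨?_, ?_⟩, mem_univ _, rfl⟩
    · exact fun i j h => hinj (congrArg Subtype.val h)
    · rintro ⟨a, ha⟩
      obtain ⟨i, -, hi⟩ := mem_image.1 (himg ▸ ha)
      exact ⟨i, Subtype.ext hi⟩

/-- The handshake identity for the e-adjacency tensor: the sum of all entries of the
e-adjacency tensor equals `k` times the number of hyperedges of the original hypergraph. -/
theorem eAdj_handshake (n k : ℕ) (hn : 1 ≤ n) (hk : 2 ≤ k)
    (E : Finset (Finset (Fin n)))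
    (hE1 : ∀ e ∈ E, e.Nonempty) (hE2 : ∀ e ∈ E, e.card ≤ k) :
    ∑ t : Fin k → Fin (n + k - 1), eAdj n k (by omega) E t = (k : ℝ) * E.card := by
  classical
  have hk1 : 1 ≤ k := by omega
  have hcard : (univ.filter fun t : Fin k → Fin (n + k - 1) =>
      Function.Injective t ∧ ∃ e ∈ E, univ.image t = filled n k hk1 e).card
      = E.card * k.factorial := by
    have hunion : (univ.filter fun t : Fin k → Fin (n + k - 1) =>
        Function.Injective t ∧ ∃ e ∈ E, univ.image t = filled n k hk1 e)
        = E.biUnion fun e => univ.filter fun t : Fin k → Fin (n + k - 1) =>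
          Function.Injective t ∧ univ.image t = filled n k hk1 e := by
      ext t
      simp only [mem_filter, mem_univ, true_and, mem_biUnion]
      tauto
    rw [hunion, card_biUnion, sum_const_nat]
    · intro e he
      simpa using card_injective_image_eq (ι := Fin k) (filled n k hk1 e)
        (by simpa using card_filled n k hk1 e (hE1 e he) (hE2 e he))
    · intro e _ f _ hef
      refine disjoint_left.2 fun t hte htf => hef (filled_injective n k hk1 ?_)
      exact (mem_filter.1 hte).2.2.symm.trans (mem_filter.1 htf).2.2
  simp only [eAdj]
  rw [← sum_filter, sum_const, nsmul_eq_mul]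
  have hfac : (k.factorial : ℝ) = k * (k - 1).factorial := by
    exact_mod_cast (Nat.mul_factorial_pred (by omega)).symm
  have hpos : ((k - 1).factorial : ℝ) ≠ 0 := by exact_mod_cast (k - 1).factorial_ne_zero
  calc _ = ((E.card * k.factorial : ℕ) : ℝ) * (1 / ((k - 1).factorial : ℝ)) := by
        rw [← hcard]
    _ = _ := by
        rw [Nat.cast_mul, hfac]
        field_simp
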